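/- arXiv:2401.03320 — 9 statements merged into one kernel-verified Lean document; each statement's English description precedes it below -/
import Mathlib

section
/- If the direct product \prod_{i \in I} R_i of a family of rings is a GUSC ring, then each factor R_i is a GUSC ring. -/
/-- An element `a` is uniquely strongly clean if there is exactly one idempotent `e`
such that `a - e` is a unit and `a * e = e * a`. -/
def IsUniquelyStronglyClean {R : Type*} [Ring R] (a : R) : Prop :=
  ∃! e : R, IsIdempotentElem e ∧ IsUnit (a - e) ∧ a * e = e * a

/-- A ring is GUSC if every non-invertible element is uniquely strongly clean. -/
def IsGUSCRing (R : Type*) [Ring R] : Prop :=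
  ∀ a : R, ¬ IsUnit a → IsUniquelyStronglyClean a

/-- An element `a` is uniquely clean if there is exactly one idempotent `e`
such that `a - e` is a unit. -/
def IsUniquelyClean {R : Type*} [Ring R] (a : R) : Prop :=
  ∃! e : R, IsIdempotentElem e ∧ IsUnit (a - e)

/-- A ring is GUC if every non-invertible element is uniquely clean. -/
def IsGUCRing (R : Type*) [Ring R] : Prop :=
  ∀ a : R, ¬ IsUnit a → IsUniquelyClean a

/-- `a` lies in the Jacobson radical: `1 - a * y` is a unit for every `y`. -/
def InJacobson {R : Type*} [Ring R] (a : R) : Prop :=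
  ∀ y : R, IsUnit (1 - a * y)

/-- If a direct product of rings is GUSC, then each factor is GUSC. -/
theorem gusc_of_pi {I : Type*} (R : I → Type*) [∀ i, Ring (R i)]
    (h : IsGUSCRing (∀ i, R i)) : ∀ i, IsGUSCRing (R i) := by
  intro i a ha
  classical
  obtain ⟨E, ⟨hE1, hE2, hE3⟩, hE4⟩ := h (Function.update 0 i a) (by
    intro hu
    apply ha
    simpa using hu.map (Pi.evalRingHom R i))
  have key : ∀ e : R i, IsIdempotentElem e → IsUnit (a - e) → a * e = e * a → e = E i := by
    intro e h1 h2 h3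
    have := hE4 (Function.update E i e) ⟨?_, ?_, ?_⟩
    · simpa using congrFun this i
    · funext j
      by_cases hj : j = i
      · subst hj
        simpa using h1.eq
      · simpa [hj] using congrFun hE1 j
    · rw [Pi.isUnit_iff] at hE2 ⊢
      intro j
      by_cases hj : j = i
      · subst hj
        simpa using h2
      · simpa [hj] using hE2 j
    · funext j
      by_cases hj : j = i
      · subst hj
        simpa using h3
      · simp [hj]
  refine ⟨E i, ⟨congrFun hE1 i, ?_, ?_⟩, fun e he => key e he.1 he.2.1 he.2.2⟩
  · simpa using hE2.map (Pi.evalRingHom R i)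
  · simpa using congrFun hE3 i
end

section
/- Let I be an index type containing at least two distinct elements and let (R_i)_{i \in I} be a family of nontrivial rings. Then the direct product \prod_{i \in I} R_i is a GUSC ring if and only if every R_i is a uniquely strongly clean (USC) ring. -/
theorem pi_usc_iff {I : Type*} (R : I → Type*) [∀ i, Ring (R i)] (a : ∀ i, R i) :
    IsUniquelyStronglyClean a ↔ ∀ i, IsUniquelyStronglyClean (a i) := by
  classical
  have key : ∀ e : ∀ i, R i, (IsIdempotentElem e ∧ IsUnit (a - e) ∧ a * e = e * a) ↔
      ∀ i, (IsIdempotentElem (e i) ∧ IsUnit (a i - e i) ∧ a i * e i = e i * a i) := by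
    intro e
    simp only [IsIdempotentElem, Pi.isUnit_iff, funext_iff, Pi.mul_apply, Pi.sub_apply,
      forall_and]
  constructor
  · rintro ⟨e, he, hu⟩ i
    have he' := (key e).1 he
    refine ⟨e i, he' i, ?_⟩
    intro f hf
    have h := hu (Function.update e i f) ((key _).2 ?_)
    · have := congrFun h i
      simpa using this
    · intro j
      by_cases hj : j = i
      · subst hj
        simpa using hf
      · simpa [hj] using he' j
  · intro h
    choose e he hu using h
    refine ⟨e, (key e).2 he, ?_⟩
    intro f hf
    funext i
    exact hu i (f i) ((key f).1 hf i)

/-- If the index type has at least two elements and all factors are nontrivial, the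
direct product is GUSC iff every factor is uniquely strongly clean (USC). -/
theorem pi_gusc_iff_forall_usc {I : Type*} (R : I → Type*) [∀ i, Ring (R i)]
    [∀ i, Nontrivial (R i)] (hI : ∃ i j : I, i ≠ j) :
    IsGUSCRing (∀ i, R i) ↔ ∀ i, ∀ a : R i, IsUniquelyStronglyClean a := by
  classical
  constructor
  · intro h i a
    obtain ⟨j, hj⟩ : ∃ j, j ≠ i := by
      obtain ⟨p, q, hpq⟩ := hI
      by_cases hp : p = i
      · exact ⟨q, fun hq => hpq (hp.trans hq.symm)⟩
      · exact ⟨p, hp⟩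
    have hn : ¬ IsUnit (Function.update (0 : ∀ i, R i) i a) := by
      intro hu
      have := Pi.isUnit_iff.1 hu j
      simp [hj] at this
    have := (pi_usc_iff R _).1 (h _ hn) i
    simpa using this
  · intro h a _
    exact (pi_usc_iff R a).2 fun i => h i (a i)
end

section
/- For a nontrivial ring R, the following conditions are equivalent: (1) R is a local ring; (2) R is a GUSC ring and the only idempotents of R are 0 and 1; (3) R is a strongly clean ring and the only idempotents of R are 0 and 1; (4) R is a clean ring and the only idempotents of R are 0 and 1; (5) R is a GUC ring and the only idempotents of R are 0 and 1. -/
/-- For a nontrivial ring, local, (GUSC with trivial idempotents), (strongly clean with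
trivial idempotents), (clean with trivial idempotents) and (GUC with trivial idempotents)
are all equivalent. -/
theorem isLocalRing_tfae (R : Type*) [Ring R] [Nontrivial R] :
    List.TFAE
      [ IsLocalRing R,
        IsGUSCRing R ∧ ∀ e : R, IsIdempotentElem e → e = 0 ∨ e = 1,
        (∀ a : R, ∃ e : R, IsIdempotentElem e ∧ IsUnit (a - e) ∧ a * e = e * a) ∧
          ∀ e : R, IsIdempotentElem e → e = 0 ∨ e = 1,
        (∀ a : R, ∃ e : R, IsIdempotentElem e ∧ IsUnit (a - e)) ∧
          ∀ e : R, IsIdempotentElem e → e = 0 ∨ e = 1,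
        IsGUCRing R ∧ ∀ e : R, IsIdempotentElem e → e = 0 ∨ e = 1 ] := by
  have idem : IsLocalRing R → ∀ e : R, IsIdempotentElem e → e = 0 ∨ e = 1 := by
    intro h e he
    rcases IsLocalRing.isUnit_or_isUnit_of_add_one (add_sub_cancel e 1) with hu | hu
    · right
      exact hu.mul_left_cancel (by rw [he.eq, mul_one])
    · left
      exact hu.mul_left_cancel (by rw [sub_mul, he.eq, one_mul, sub_self, mul_zero])
  have sub : IsLocalRing R → ∀ a : R, ¬ IsUnit a → IsUnit (a - 1) := by
    intro h a ha
    rcases IsLocalRing.isUnit_or_isUnit_of_add_one (add_sub_cancel a 1) with hu | hu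
    · exact absurd hu ha
    · rw [← neg_sub]
      exact hu.neg
  tfae_have 1 → 2 := by
    intro h
    refine ⟨fun a ha => ⟨1, ⟨IsIdempotentElem.one, sub h a ha, by simp⟩, ?_⟩, idem h⟩
    rintro e ⟨he, hu, -⟩
    rcases idem h e he with rfl | rfl
    · exact absurd (by simpa using hu) ha
    · rfl
  tfae_have 1 → 5 := by
    intro h
    refine ⟨fun a ha => ⟨1, ⟨IsIdempotentElem.one, sub h a ha⟩, ?_⟩, idem h⟩
    rintro e ⟨he, hu⟩
    rcases idem h e he with rfl | rfl
    · exact absurd (by simpa using hu) ha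
    · rfl
  tfae_have 2 → 3 := by
    rintro ⟨h, hi⟩
    refine ⟨fun a => ?_, hi⟩
    by_cases ha : IsUnit a
    · exact ⟨0, IsIdempotentElem.zero, by simpa using ha, by simp⟩
    · exact (h a ha).exists
  tfae_have 5 → 4 := by
    rintro ⟨h, hi⟩
    refine ⟨fun a => ?_, hi⟩
    by_cases ha : IsUnit a
    · exact ⟨0, IsIdempotentElem.zero, by simpa using ha⟩
    · exact (h a ha).exists
  tfae_have 3 → 4 := by
    rintro ⟨h, hi⟩
    refine ⟨fun a => ?_, hi⟩
    obtain ⟨e, he, hu, -⟩ := h a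
    exact ⟨e, he, hu⟩
  tfae_have 4 → 1 := by
    rintro ⟨h, hi⟩
    refine ⟨fun {a b} hab => ?_⟩
    obtain ⟨e, he, hu⟩ := h a
    rcases hi e he with rfl | rfl
    · left
      simpa using hu
    · right
      have hb : b = -(a - 1) := by rw [← hab]; abel
      rw [hb]
      exact hu.neg
  tfae_finish
end

section
/- If R is a GUSC ring, then for every natural number n, the element n\cdot 1_R of R either lies in J(R) or is a unit of R. -/
theorem gusc_aux_half {R : Type*} [Ring R] (hR : IsGUSCRing R) (e t : R) (he : e * e = e)
    (h2 : t + t = e) (h1 : e * t = t) (h3 : t * e = t) : e = 0 ∨ e = 1 := by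
  by_cases hu : IsUnit (e + e)
  · right
    have h : (e + e) * (1 - e) = 0 := by
      simp only [mul_sub, add_mul, he, mul_one, sub_self]
    have := hu.mul_right_eq_zero.1 h
    exact (sub_eq_zero.1 this).symm
  · left
    obtain ⟨f, -, hf⟩ := hR _ hu
    have e1 := hf 1 ⟨one_mul 1, ⟨⟨e + e - 1, e + e - 1, ?_, ?_⟩, rfl⟩, by simp⟩
    have e2 := hf (1 - e) ⟨?_, ⟨⟨e + e - (1 - e), t - (1 - e), ?_, ?_⟩, rfl⟩, ?_⟩
    · have : (1 : R) = 1 - e := e1.trans e2.symm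
      exact sub_eq_self.1 this.symm
    · show (1 - e) * (1 - e) = 1 - e
      simp only [mul_sub, sub_mul, mul_add, add_mul, mul_one, one_mul, he, h1, h3, h2]
      abel
    · simp only [mul_sub, sub_mul, mul_add, add_mul, mul_one, one_mul, he, h1, h3, h2]
      abel
    · simp only [mul_sub, sub_mul, mul_add, add_mul, mul_one, one_mul, he, h1, h3, h2]
      abel_nf
      rw [two_zsmul, h2]
      abel
    · simp only [mul_sub, sub_mul, mul_add, add_mul, mul_one, one_mul, he, h1, h3, h2]
      abel
    · simp only [mul_sub, sub_mul, mul_add, add_mul, mul_one, one_mul, he, h1, h3, h2]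
      abel
    · simp only [mul_sub, sub_mul, mul_add, add_mul, mul_one, one_mul, he, h1, h3, h2]
      abel

theorem gusc_aux_two {R : Type*} [Ring R] (hR : IsGUSCRing R) :
    InJacobson (2 : R) ∨ ∀ e : R, e * e = e → e = 0 ∨ e = 1 := by
  by_cases h : InJacobson (2 : R)
  · exact Or.inl h
  right
  unfold InJacobson at h
  push Not at h
  obtain ⟨y, hy⟩ := h
  obtain ⟨g, ⟨hg, ⟨w, hw⟩, hc⟩, -⟩ := hR _ hy
  have hg : g * g = g := hg
  have hcw : (w : R) * g = g * w := by rw [hw, sub_mul, mul_sub, hc]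
  have hci : (↑w⁻¹ : R) * g = g * ↑w⁻¹ := by
    rw [Units.inv_mul_eq_iff_eq_mul, ← mul_assoc, hcw, mul_assoc, Units.mul_inv, mul_one]
  have h2 : -(g * y * g * ↑w⁻¹) + -(g * y * g * ↑w⁻¹) = g := by
    have : g * w * g = -(g * y * g) + -(g * y * g) := by
      rw [hw, two_mul]; simp only [mul_sub, sub_mul, mul_add, add_mul, mul_one, one_mul, ← mul_assoc, hg]; abel
    rw [← neg_mul, ← add_mul, ← this, mul_assoc g, hcw, ← mul_assoc, hg, mul_assoc,
      Units.mul_inv, mul_one]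
  have h1 : g * -(g * y * g * ↑w⁻¹) = -(g * y * g * ↑w⁻¹) := by
    rw [mul_neg]; simp only [← mul_assoc, hg]
  have h3 : -(g * y * g * ↑w⁻¹) * g = -(g * y * g * ↑w⁻¹) := by
    rw [neg_mul, mul_assoc _ _ g, hci, ← mul_assoc, mul_assoc _ g g, hg]
  rcases gusc_aux_half hR g _ hg h2 h1 h3 with h0 | h0
  · exact absurd ⟨w, by rw [hw, h0, sub_zero]⟩ hy
  · intro e he
    generalize -(g * y * g * ↑w⁻¹) = t at h2
    refine gusc_aux_half hR e (e * t * e) he ?_ ?_ ?_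
    · rw [← add_mul, ← mul_add, h2, h0, mul_one, he]
    · simp only [← mul_assoc, he]
    · rw [mul_assoc, he]

/-- In a GUSC ring, every n·1 lies in J(R) or is a unit. -/
theorem gusc_natCast_mem_jacobson_or_isUnit {R : Type*} [Ring R] (hR : IsGUSCRing R) :
    ∀ n : ℕ, InJacobson ((n : R)) ∨ IsUnit ((n : R)) := by
  intro n
  rcases gusc_aux_two hR with h | h
  · rcases Nat.even_or_odd' n with ⟨k, rfl | rfl⟩
    · left
      intro y
      have := h (k * y)
      rw [← mul_assoc] at this
      push_cast
      exact this
    · right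
      have := h (-(k : R))
      push_cast
      rwa [mul_neg, sub_neg_eq_add, add_comm] at this
  · by_cases hn : IsUnit (n : R)
    · exact Or.inr hn
    left
    intro y
    have hny : ¬ IsUnit ((n : R) * y) := fun hu =>
      hn (((Nat.cast_commute n y).isUnit_mul_iff.1 hu).1)
    obtain ⟨e, ⟨he, hu, -⟩, -⟩ := hR _ hny
    rcases h e he with rfl | rfl
    · exact absurd (by simpa using hu) hny
    · rw [← neg_sub]; exact hu.neg
end

section
/- If R is a nontrivial commutative ring, then the polynomial ring R[x] is not a GUSC ring. -/
/-- The polynomial ring over a nontrivial commutative ring is not GUSC. -/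
theorem polynomial_not_gusc {R : Type*} [CommRing R] [Nontrivial R] :
    ¬ IsGUSCRing (Polynomial R) := by
  intro h
  obtain ⟨m, hm⟩ := Ideal.exists_maximal R
  have key : ∀ e : Polynomial R, IsIdempotentElem e → ¬ IsUnit (Polynomial.X - e) := by
    intro e he hu
    have h1 := hu.map (Polynomial.mapRingHom (Ideal.Quotient.mk m))
    have h2 := he.map (Polynomial.mapRingHom (Ideal.Quotient.mk m))
    rw [map_sub] at h1
    rcases IsIdempotentElem.iff_eq_zero_or_one.mp h2 with h0 | h0
    · rw [h0] at h1
      simp at h1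
      exact Polynomial.not_isUnit_X h1
    · rw [h0] at h1
      have h3 := Polynomial.not_isUnit_X_sub_C (1 : R ⧸ m)
      simp at h1 h3
      exact h3 h1
  have hX : ¬ IsUnit (Polynomial.X : Polynomial R) := by
    simpa using key 0 IsIdempotentElem.zero
  obtain ⟨e, ⟨he, hu, _⟩, _⟩ := h _ hX
  exact key e he hu
end

section
/- If R is a local ring, then ucn(R) = ucn_0(R): an element a of R is uniquely clean if and only if a = e + j for some central idempotent e of R and some j \in J(R). -/
theorem aux_idem {R : Type*} [Ring R] [IsLocalRing R] {e : R} (h : IsIdempotentElem e) :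
    e = 0 ∨ e = 1 := by
  have h' : e * e = e := h
  rcases IsLocalRing.isUnit_or_isUnit_of_add_one (a := e) (b := 1 - e) (by abel) with hu | hu
  · right
    exact hu.mul_left_cancel (by rw [h', mul_one])
  · left
    exact hu.mul_left_cancel (by rw [sub_mul, one_mul, h', sub_self, mul_zero])

theorem aux_right_inv {R : Type*} [Ring R] [IsLocalRing R] {a b : R} (h : a * b = 1) :
    IsUnit a := by
  have hi : IsIdempotentElem (b * a) := by
    change b * a * (b * a) = b * a
    rw [mul_assoc, ← mul_assoc a b a, h, one_mul]
  rcases aux_idem hi with h0 | h1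
  · exfalso
    have : (1 : R) = 0 := by
      calc (1 : R) = a * b * (a * b) := by rw [h, one_mul]
        _ = a * (b * a) * b := by simp only [mul_assoc]
        _ = 0 := by rw [h0, mul_zero, zero_mul]
    exact one_ne_zero this
  · exact ⟨⟨a, b, h, h1⟩, rfl⟩

theorem aux_jac {R : Type*} [Ring R] [IsLocalRing R] {a : R} : InJacobson a ↔ ¬ IsUnit a := by
  constructor
  · rintro h ⟨u, rfl⟩
    have := h (↑u⁻¹ : R)
    rw [Units.mul_inv, sub_self] at this
    exact not_isUnit_zero this
  · intro h y
    rcases IsLocalRing.isUnit_or_isUnit_of_add_one (a := a * y) (b := 1 - a * y) (by abel)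
      with hu | hu
    · obtain ⟨u, hu⟩ := hu
      exact absurd (aux_right_inv (b := y * (↑u⁻¹ : R))
        (by rw [← mul_assoc, ← hu, Units.mul_inv])) h
    · exact hu

/-- In a local ring, ucn(R) = ucn₀(R). -/
theorem local_ucn_eq_ucn0 {R : Type*} [Ring R] [IsLocalRing R] :
    ∀ a : R, IsUniquelyClean a ↔
      ∃ e j : R, IsIdempotentElem e ∧ (∀ r : R, e * r = r * e) ∧ InJacobson j ∧ a = e + j := by
  intro a
  constructor
  · rintro ⟨e, ⟨-, -⟩, huniq⟩
    by_cases h0 : IsUnit a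
    · refine ⟨1, a - 1, IsIdempotentElem.one, by simp, aux_jac.2 fun h1 => ?_, by abel⟩
      have e0 := huniq 0 ⟨IsIdempotentElem.zero, by simpa using h0⟩
      have e1 := huniq 1 ⟨IsIdempotentElem.one, h1⟩
      exact zero_ne_one (e0.trans e1.symm)
    · exact ⟨0, a, IsIdempotentElem.zero, by simp, aux_jac.2 h0, by simp⟩
  · rintro ⟨e, j, he, -, hj, rfl⟩
    have hn := aux_jac.1 hj
    rcases aux_idem he with rfl | rfl
    · refine ⟨1, ⟨IsIdempotentElem.one, ?_⟩, ?_⟩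
      · have := (hj 1).neg
        simpa using this
      · rintro f ⟨hf, hu⟩
        rcases aux_idem hf with rfl | rfl
        · exact absurd (by simpa using hu) hn
        · rfl
    · refine ⟨0, ⟨IsIdempotentElem.zero, ?_⟩, ?_⟩
      · have := hj (-1)
        simpa using this
      · rintro f ⟨hf, hu⟩
        rcases aux_idem hf with rfl | rfl
        · rfl
        · exact absurd (by simpa using hu) hn
end

section
/- If R is a USC ring, then ucn(R) = ucn_0(R): an element a of R is uniquely clean if and only if a = e + j for some central idempotent e of R and some j \in J(R). -/
theorem aux_swap {R : Type*} [Ring R] (x y : R) (h : IsUnit (1 - x * y)) :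
    IsUnit (1 - y * x) := by
  obtain ⟨u, hu⟩ := h
  have h1 : (1 - x * y) * (↑u⁻¹ : R) = 1 := by rw [← hu]; simp
  have h2 : (↑u⁻¹ : R) * (1 - x * y) = 1 := by rw [← hu]; simp
  set v : R := (↑u⁻¹ : R)
  refine isUnit_iff_exists.2 ⟨1 + y * v * x, ?_, ?_⟩
  · have : (1 - y * x) * (1 + y * v * x) = 1 - y * x + y * ((1 - x * y) * v) * x := by noncomm_ring
    rw [this, h1]; simp
  · have : (1 + y * v * x) * (1 - y * x) = 1 - y * x + y * (v * (1 - x * y)) * x := by noncomm_ring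
    rw [this, h2]; simp

theorem aux_jac_left {R : Type*} [Ring R] {k : R} (hk : k ∈ Ring.jacobson R) :
    ∃ z, z * (1 + k) = 1 := by
  rw [← Ideal.jacobson_bot, Ideal.mem_jacobson_iff] at hk
  obtain ⟨z, hz⟩ := hk 1
  refine ⟨z, ?_⟩
  rw [Ideal.mem_bot, sub_eq_zero, mul_one] at hz
  rw [mul_add, mul_one, add_comm]; exact hz

theorem aux_jac_unit {R : Type*} [Ring R] {k : R} (hk : k ∈ Ring.jacobson R) :
    IsUnit (1 + k) := by
  obtain ⟨z, hz⟩ := aux_jac_left hk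
  have hzk : -(z * k) ∈ Ring.jacobson R := neg_mem (Ideal.mul_mem_left _ _ hk)
  obtain ⟨w, hw⟩ := aux_jac_left hzk
  have e : 1 + -(z * k) = z := by
    rw [mul_add, mul_one] at hz
    rw [← hz]; abel
  rw [e] at hw
  have : w = 1 + k := by
    calc w = w * (z * (1 + k)) := by rw [hz, mul_one]
      _ = 1 + k := by rw [← mul_assoc, hw, one_mul]
  rw [this] at hw
  exact isUnit_iff_exists.2 ⟨z, hw, hz⟩

theorem aux_inJ {R : Type*} [Ring R] (x : R) :
    InJacobson x ↔ Ideal.Quotient.mk (Ring.jacobson R) x = 0 := by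
  rw [Ideal.Quotient.eq_zero_iff_mem]
  constructor
  · intro h
    rw [← Ideal.jacobson_bot, Ideal.mem_jacobson_iff]
    intro y
    obtain ⟨u, hu⟩ := aux_swap _ _ (h (-y))
    refine ⟨(↑u⁻¹ : R), ?_⟩
    have h2 : (↑u⁻¹ : R) * (1 - -y * x) = 1 := by rw [← hu]; simp
    rw [Ideal.mem_bot, sub_eq_zero, ← h2]
    noncomm_ring
  · intro h y
    have := aux_jac_unit (neg_mem (Ideal.mul_mem_right y _ h))
    rwa [← sub_eq_add_neg] at this

theorem aux_local {R : Type*} [Ring R] (x : R)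
    (h : IsUnit (Ideal.Quotient.mk (Ring.jacobson R) x)) : IsUnit x := by
  obtain ⟨b, h1, h2⟩ := isUnit_iff_exists.1 h
  obtain ⟨b, rfl⟩ := Ideal.Quotient.mk_surjective b
  have key : ∀ c : R, Ideal.Quotient.mk (Ring.jacobson R) c = 1 → IsUnit c := by
    intro c hc
    have : c - 1 ∈ Ring.jacobson R := by
      rw [← Ideal.Quotient.eq_zero_iff_mem]; simp [hc]
    simpa using aux_jac_unit this
  obtain ⟨u, hu⟩ := key (x * b) (by simpa using h1)
  obtain ⟨v, hv⟩ := key (b * x) (by simpa using h2)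
  have hr : x * (b * (↑u⁻¹ : R)) = 1 := by rw [← mul_assoc, ← hu]; simp
  have hl : ((↑v⁻¹ : R) * b) * x = 1 := by rw [mul_assoc, ← hv]; simp
  exact isUnit_iff_exists.2 ⟨_, hr, by rwa [← left_inv_eq_right_inv hl hr]⟩

theorem aux_zero {R : Type*} [Ring R] (hR : ∀ a : R, IsUniquelyStronglyClean a)
    {u e : R} (hu : IsUnit u) (he : IsIdempotentElem e) (hue : IsUnit (u - e))
    (hc : u * e = e * u) : e = 0 :=
  (hR u).unique ⟨he, hue, hc⟩ ⟨by simp [IsIdempotentElem], by simpa using hu, by simp⟩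

/-- No 2x2 matrix units. -/
theorem aux_matrix {R : Type*} [Ring R] (hR : ∀ a : R, IsUniquelyStronglyClean a)
    (s t : R) (hs : s * s = 0) (ht : t * t = 0) (hst : s * t * s = s) (hts : t * s * t = t) :
    s = 0 := by
  rw [mul_assoc] at hst hts
  have hs' : ∀ w, s * (s * w) = 0 := fun w => by rw [← mul_assoc, hs, zero_mul]
  have ht' : ∀ w, t * (t * w) = 0 := fun w => by rw [← mul_assoc, ht, zero_mul]
  have hst' : ∀ w, s * (t * (s * w)) = s * w := fun w => by
    rw [← mul_assoc t, ← mul_assoc, hst]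
  have hts' : ∀ w, t * (s * (t * w)) = t * w := fun w => by
    rw [← mul_assoc s, ← mul_assoc, hts]
  have a1 : (1 + s + t - t * s) * (1 + s + t - t * s - (s * t + t * s)) = 1 := by
    simp only [mul_add, add_mul, mul_sub, sub_mul, mul_one, one_mul, mul_assoc, hs, ht, hst, hts,
      hs', ht', hst', hts', mul_zero]
    abel
  have a2 : (1 + s + t - t * s - (s * t + t * s)) * (1 + s + t - t * s) = 1 := by
    simp only [mul_add, add_mul, mul_sub, sub_mul, mul_one, one_mul, mul_assoc, hs, ht, hst, hts,
      hs', ht', hst', hts', mul_zero]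
    abel
  have h0 : s * t + t * s = 0 := by
    refine aux_zero hR (u := 1 + s + t - t * s) (isUnit_iff_exists.2 ⟨_, a1, a2⟩) ?_
      (isUnit_iff_exists.2 ⟨_, a2, a1⟩) ?_
    · unfold IsIdempotentElem
      simp only [mul_add, add_mul, mul_assoc, hs, ht, hst, hts,
        hs', ht', hst', hts', mul_zero]
      abel
    · simp only [mul_add, add_mul, mul_sub, sub_mul, mul_one, one_mul, mul_assoc, hs, ht, hst, hts,
        hs', ht', hst', hts', mul_zero]
      abel
  calc s = s * (s * t + t * s) := by rw [mul_add, hst, hs', zero_add]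
    _ = 0 := by rw [h0, mul_zero]

theorem aux_idem_s14 {R : Type*} [Ring R] (hR : ∀ a : R, IsUniquelyStronglyClean a)
    (x : R) (hx : Ideal.Quotient.mk (Ring.jacobson R) x ≠ 0) :
    ∃ z, x * z ≠ 0 ∧ z * x * z = z := by
  rw [Ne, ← aux_inJ, InJacobson] at hx
  push Not at hx
  obtain ⟨y, hy⟩ := hx
  obtain ⟨e, ⟨he, ⟨v, hv⟩, hc⟩, -⟩ := hR (x * y)
  have hve : (v : R) * (1 - e) = (1 - e) * v := by
    rw [hv]; simp only [mul_sub, sub_mul, mul_one, one_mul, hc]; abel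
  have hg : (1 - e) * (1 - e) = 1 - e := he.one_sub
  have hxg : x * y * (1 - e) = v * (1 - e) := by
    rw [hv, sub_mul, mul_sub e, he.eq]; simp
  have hvi : (1 - e) * (↑v⁻¹ : R) = ↑v⁻¹ * (1 - e) :=
    (Commute.units_inv_right (show Commute (1 - e) (v : R) from hve.symm)).eq
  have hxz : x * (y * (1 - e) * ↑v⁻¹) = 1 - e := by
    rw [← mul_assoc, ← mul_assoc, hxg, hve, mul_assoc]; simp
  refine ⟨y * (1 - e) * ↑v⁻¹, ?_, ?_⟩
  · rw [hxz]
    intro h0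
    apply hy
    have he1 : e = 1 := (sub_eq_zero.1 h0).symm
    rw [he1] at hv
    rw [← neg_sub, ← hv]
    exact v.isUnit.neg
  · rw [mul_assoc, hxz, mul_assoc, mul_assoc, ← hvi, ← mul_assoc (1 - e), hg, mul_assoc]

theorem aux_nil {R : Type*} [Ring R] (hR : ∀ a : R, IsUniquelyStronglyClean a)
    (x : R) (hx : x * x = 0) : Ideal.Quotient.mk (Ring.jacobson R) x = 0 := by
  by_contra hne
  obtain ⟨z, h0, hz⟩ := aux_idem_s14 hR x hne
  rw [mul_assoc] at hz
  have hx' : ∀ w, x * (x * w) = 0 := fun w => by rw [← mul_assoc, hx, zero_mul]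
  have hz' : ∀ w, z * (x * (z * w)) = z * w := fun w => by
    rw [← mul_assoc x, ← mul_assoc, hz]
  have := aux_matrix hR (x * z * x) (z - x * z * z)
    (by simp only [mul_assoc, hx', mul_zero])
    (by simp only [mul_sub, sub_mul, mul_assoc, hz']; abel)
    (by simp only [mul_sub, sub_mul, mul_assoc, hz', hx', mul_zero, zero_mul]; abel)
    (by simp only [mul_sub, sub_mul, mul_assoc, hz', hx', hz, mul_zero, zero_mul]; abel)
  apply h0
  calc x * z = x * z * x * z := by rw [mul_assoc, mul_assoc, hz]
    _ = 0 := by rw [this, zero_mul]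

theorem aux_central {R : Type*} [Ring R] (hR : ∀ a : R, IsUniquelyStronglyClean a)
    (g : R) (hg : g * g = g) (r : R) :
    Ideal.Quotient.mk (Ring.jacobson R) g * Ideal.Quotient.mk (Ring.jacobson R) r =
    Ideal.Quotient.mk (Ring.jacobson R) r * Ideal.Quotient.mk (Ring.jacobson R) g := by
  have hg' : ∀ w, g * (g * w) = g * w := fun w => by rw [← mul_assoc, hg]
  have h1 := aux_nil hR (g * r * (1 - g))
    (by simp only [mul_sub, sub_mul, mul_assoc, hg', hg, mul_one]; abel)
  have h2 := aux_nil hR ((1 - g) * r * g)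
    (by simp only [mul_sub, sub_mul, mul_assoc, hg', hg, one_mul]; abel)
  simp only [map_mul, map_sub, map_one, mul_sub, sub_mul, mul_one, one_mul, sub_eq_zero] at h1 h2
  rw [h1, h2]

theorem aux_units {R : Type*} [Ring R] (hR : ∀ a : R, IsUniquelyStronglyClean a)
    (u : R) (hu : IsUnit u) : Ideal.Quotient.mk (Ring.jacobson R) u = 1 := by
  by_contra hne
  have hne' : Ideal.Quotient.mk (Ring.jacobson R) (1 - u) ≠ 0 := by
    intro h; apply hne; rw [map_sub, map_one, sub_eq_zero] at h; exact h.symm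
  obtain ⟨z, h0, hz⟩ := aux_idem_s14 hR (1 - u) hne'
  apply h0
  obtain ⟨g, hgdef⟩ : ∃ g, g = (1 - u) * z := ⟨_, rfl⟩
  rw [← hgdef]
  have hg : g * g = g := by
    rw [hgdef, mul_assoc, ← mul_assoc z, hz]
  have hp : (z * (1 - u)) * (z * (1 - u)) = z * (1 - u) := by
    rw [← mul_assoc, hz]
  have cg := aux_central hR g hg
  have cp := aux_central hR _ hp
  obtain ⟨v, huv, hvu⟩ := isUnit_iff_exists.1 hu
  set π := Ideal.Quotient.mk (Ring.jacobson R)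
  have hG : π g * π g = π g := by rw [← map_mul, hg]
  have hZ : π z * π g = π z := by rw [← map_mul, hgdef, ← mul_assoc, hz]
  have hXZ : π (1 - u) * π z = π g := by rw [← map_mul, hgdef]
  have hZX : π z * π (1 - u) = π g := by
    have e1 : π (z * (1 - u)) = π g * π (z * (1 - u)) := by
      rw [map_mul, ← mul_assoc, cg, hZ]
    have e2 : π g = π g * π (z * (1 - u)) := by
      rw [← cp g]
      nth_rewrite 2 [← hXZ]
      rw [← mul_assoc, cp, mul_assoc, ← map_mul, hz, hXZ]
    rw [← map_mul, e1, ← e2]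
  have hG' : ∀ w, π g * (π g * w) = π g * w := fun w => by rw [← mul_assoc, hG]
  have cg' : ∀ r w, π r * (π g * w) = π g * (π r * w) := fun r w => by
    rw [← mul_assoc, ← cg, mul_assoc]
  have hUV : π u * π v = 1 := by rw [← map_mul, huv, map_one]
  have hVU : π v * π u = 1 := by rw [← map_mul, hvu, map_one]
  refine aux_zero hR (u := g * u * g + (1 - g)) (aux_local _ ?_) hg (aux_local _ ?_) ?_
  · change IsUnit (π (g * u * g + (1 - g)))
    refine isUnit_iff_exists.2 ⟨π g * π v + (1 - π g), ?_, ?_⟩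
    · simp only [map_add, map_mul, map_sub, map_one, mul_add, add_mul, mul_sub, sub_mul, mul_assoc,
        mul_one, one_mul, ← cg, cg', hG, hG', hUV]
      abel
    · simp only [map_add, map_mul, map_sub, map_one, mul_add, add_mul, mul_sub, sub_mul, mul_assoc,
        mul_one, one_mul, ← cg, cg', hG, hG', hVU]
      abel
  · have e : π (g * u * g + (1 - g) - g) = (1 - π g) - π g * π (1 - u) := by
      simp only [map_add, map_mul, map_sub, map_one, mul_sub, mul_assoc, mul_one, ← cg, hG']
      abel
    rw [e]
    refine isUnit_iff_exists.2 ⟨(1 - π g) - π g * π z, ?_, ?_⟩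
    · simp only [mul_sub, sub_mul, mul_assoc,
        mul_one, one_mul, ← cg, cg', hG, hG', hXZ]
      abel
    · simp only [mul_sub, sub_mul, mul_assoc,
        mul_one, one_mul, ← cg, cg', hG, hG', hZX]
      abel
  · have hg' : ∀ w, g * (g * w) = g * w := fun w => by rw [← mul_assoc, hg]
    simp only [mul_add, add_mul, mul_sub, sub_mul, mul_assoc, mul_one, one_mul, hg, hg']

/-- In a USC ring, ucn(R) = ucn₀(R). -/
theorem usc_ucn_eq_ucn0 {R : Type*} [Ring R]
    (hR : ∀ a : R, IsUniquelyStronglyClean a) :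
    ∀ a : R, IsUniquelyClean a ↔
      ∃ e j : R, IsIdempotentElem e ∧ (∀ r : R, e * r = r * e) ∧ InJacobson j ∧ a = e + j := by
  intro a
  have hU := aux_units hR
  have two : (1 : R ⧸ Ring.jacobson R) + 1 = 0 := by
    have := hU (-1) isUnit_one.neg
    rw [map_neg, map_one] at this
    nth_rewrite 1 [← this]
    simp
  have two' : ∀ x : R ⧸ Ring.jacobson R, x + x = 0 := fun x => by
    have := congrArg (· * x) two
    simpa [add_mul] using this
  constructor
  · rintro ⟨e, ⟨he, hu⟩, huniq⟩
    have hpert : ∀ n : R, n * n = 0 → IsIdempotentElem (e + n) → n = 0 := by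
      intro n hn hi
      have h1 := huniq (e + n) ⟨hi, aux_local _ ?_⟩
      · simpa using h1
      · have : a - (e + n) = (a - e) - n := by abel
        rw [this, map_sub, aux_nil hR n hn, sub_zero]
        exact hu.map _
    have he' : e * e = e := he
    have he'' : ∀ w, e * (e * w) = e * w := fun w => by rw [← mul_assoc, he']
    refine ⟨1 - e, a - (1 - e), he.one_sub, ?_, ?_, by abel⟩
    · intro r
      have h1 := hpert (e * r * (1 - e))
        (by simp only [mul_sub, sub_mul, mul_assoc, he'', he', mul_one]; abel)
        (by unfold IsIdempotentElem
            simp only [mul_add, add_mul, mul_sub, sub_mul, mul_assoc, he'', he', mul_one]; abel)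
      have h2 := hpert ((1 - e) * r * e)
        (by simp only [mul_sub, sub_mul, mul_assoc, he'', he', one_mul]; abel)
        (by unfold IsIdempotentElem
            simp only [mul_add, add_mul, mul_sub, sub_mul, mul_assoc, he'', he', one_mul]; abel)
      simp only [mul_sub, sub_mul, mul_one, one_mul, sub_eq_zero] at h1 h2
      rw [sub_mul, mul_sub, h1, h2, one_mul, mul_one]
    · rw [aux_inJ]
      have h1 := hU _ hu
      have : a - (1 - e) = (a - e) - 1 + (e + e) := by abel
      rw [this, map_add, map_sub, h1, map_add, two']
      simp
  · rintro ⟨e, j, he, hc, hj, rfl⟩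
    rw [aux_inJ] at hj
    refine ⟨1 - e, ⟨he.one_sub, aux_local _ ?_⟩, ?_⟩
    · have : e + j - (1 - e) = (e + e) + j - 1 := by abel
      rw [this, map_sub, map_add, map_add, two', hj, map_one]
      simpa using isUnit_one.neg
    · rintro f ⟨hf, hu⟩
      have h1 := hU _ hu
      rw [map_sub, map_add, hj, add_zero] at h1
      have hd : Ideal.Quotient.mk (Ring.jacobson R) (f - (1 - e)) = 0 := by
        rw [map_sub, map_sub, map_one, ← h1]
        have := two' (Ideal.Quotient.mk (Ring.jacobson R) f)
        rw [← this]; abel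
      have hf' : f * f = f := hf
      have hff : ∀ w, f * (f * w) = f * w := fun w => by rw [← mul_assoc, hf']
      have he' : e * e = e := he
      have hee : ∀ w, e * (e * w) = e * w := fun w => by rw [← mul_assoc, he']
      have hcc : ∀ w, f * (e * w) = e * (f * w) := fun w => by
        rw [← mul_assoc, ← hc, mul_assoc]
      obtain ⟨d, hdd⟩ : ∃ d, d = f - (1 - e) := ⟨_, rfl⟩
      have hcube : (1 - d * d) * d = 0 := by
        rw [hdd]
        simp only [mul_sub, sub_mul, mul_assoc, ← hc, hcc, hf', hff, he', hee, one_mul, mul_one]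
        abel
      have hunit : IsUnit (1 - d * d) := aux_local _ (by
        rw [← hdd] at hd
        rw [map_sub, map_mul, hd]; simp)
      have : d = 0 := by
        simpa using hunit.mul_left_cancel (hcube.trans (mul_zero _).symm)
      rw [hdd] at this
      exact sub_eq_zero.1 this
end

section
/- If R is a GUSC ring, then ucn(R) = ucn_0(R): an element a of R is uniquely clean if and only if a = e + j for some central idempotent e of R and some j \in J(R). -/
set_option linter.unusedSimpArgs false

theorem gaux_unit {R : Type*} [Ring R] {x y : R} (h1 : x * y = 1) (h2 : y * x = 1) : IsUnit x :=
  ⟨⟨x, y, h1, h2⟩, rfl⟩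

/-- No square-zero pair of `2 × 2` matrix units outside the full ring. -/
theorem gaux_A {R : Type*} [Ring R] (hR : IsGUSCRing R) {a b : R} (ha : a * a = 0) (hb : b * b = 0)
    (hab : a * b * a = a) (hba : b * a * b = b) (hk : a * b + b * a ≠ 1) : a = 0 := by
  have ha' : ∀ x, a * (a * x) = 0 := fun x => by rw [← mul_assoc, ha, zero_mul]
  have hb' : ∀ x, b * (b * x) = 0 := fun x => by rw [← mul_assoc, hb, zero_mul]
  have e1 : a * (b * a) = a := by rw [← mul_assoc, hab]
  have e2 : b * (a * b) = b := by rw [← mul_assoc, hba]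
  have e1' : ∀ x, a * (b * (a * x)) = a * x := fun x => by
    rw [← mul_assoc b, ← mul_assoc a, e1]
  have e2' : ∀ x, b * (a * (b * x)) = b * x := fun x => by
    rw [← mul_assoc a, ← mul_assoc b, e2]
  have hnu : ¬ IsUnit (a + b + a * b) := by
    intro hu
    have h0 : (a + b + a * b) * (1 - (a * b + b * a)) = 0 := by
      simp only [mul_add, add_mul, mul_sub, sub_mul, mul_one, one_mul, mul_assoc, ha, hb, ha', hb',
        e1, e2, e1', e2', mul_zero]
      abel
    have h1 := (hu.mul_right_eq_zero).1 h0
    exact hk (sub_eq_zero.1 h1).symm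
  have key1 : (a + b + a * b - (1 - (a * b + b * a))) * (a + b + a * b - 1) = 1 := by
    simp only [mul_add, add_mul, mul_sub, sub_mul, mul_one, one_mul, mul_assoc, ha, hb, ha', hb',
        e1, e2, e1', e2', mul_zero]
    abel
  have key2 : (a + b + a * b - 1) * (a + b + a * b - (1 - (a * b + b * a))) = 1 := by
    simp only [mul_add, add_mul, mul_sub, sub_mul, mul_one, one_mul, mul_assoc, ha, hb, ha', hb',
        e1, e2, e1', e2', mul_zero]
    abel
  have hid : IsIdempotentElem (1 - (a * b + b * a)) := by
    unfold IsIdempotentElem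
    simp only [mul_add, add_mul, mul_sub, sub_mul, mul_one, one_mul, mul_assoc, ha, hb, ha', hb',
        e1, e2, e1', e2', mul_zero]
    abel
  have hcomm : (a + b + a * b) * (1 - (a * b + b * a))
      = (1 - (a * b + b * a)) * (a + b + a * b) := by
    simp only [mul_add, add_mul, mul_sub, sub_mul, mul_one, one_mul, mul_assoc, ha, hb, ha', hb',
        e1, e2, e1', e2', mul_zero]
    abel
  have h := (hR _ hnu).unique ⟨hid, gaux_unit key1 key2, hcomm⟩
    ⟨IsIdempotentElem.one, gaux_unit key2 key1, by rw [mul_one, one_mul]⟩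
  have h0 : a * b + b * a = 0 := by
    have := sub_eq_self.1 h
    exact this
  have : (a * b + b * a) * a = a := by
    simp only [add_mul, mul_assoc, ha, e1, mul_zero, add_zero]
  rw [h0, zero_mul] at this
  exact this.symm

/-- Dedekind finiteness. -/
theorem gaux_DF {R : Type*} [Ring R] (hR : IsGUSCRing R) {z w : R} (h : z * w = 1) :
    IsUnit w := by
  have h' : ∀ x, z * (w * x) = x := fun x => by rw [← mul_assoc, h, one_mul]
  suffices hd : w * z = 1 from gaux_unit hd h
  have hcases : (1 - w * z) * z = 0 := by
    by_contra hne
    apply hne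
    apply gaux_A hR (b := w * (1 - w * z))
    · simp only [mul_sub, sub_mul, mul_one, one_mul, mul_assoc, h, h']; abel
    · simp only [mul_sub, sub_mul, mul_one, one_mul, mul_assoc, h, h']; abel
    · simp only [mul_sub, sub_mul, mul_one, one_mul, mul_assoc, h, h']; abel
    · simp only [mul_sub, sub_mul, mul_one, one_mul, mul_assoc, h, h']; abel
    · intro hk
      have h2 := congrArg (fun t => z * (z * t)) hk
      simp only [mul_add, add_mul, mul_sub, sub_mul, mul_one, one_mul, mul_assoc, h, h'] at h2
      have h3 : z * z = 0 := by rw [← h2]; abel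
      have h4 : (1 : R) = 0 := by
        calc (1 : R) = z * z * (w * w) := by simp only [mul_assoc, h, h']
          _ = 0 := by rw [h3, zero_mul]
      apply hne
      rw [← mul_one ((1 - w * z) * z), h4, mul_zero]
  have h5 : (1 - w * z) * z * w = 1 - w * z := by rw [mul_assoc, h, mul_one]
  rw [hcases, zero_mul] at h5
  exact (sub_eq_zero.1 h5.symm).symm

/-- Exchange-type lemma. -/
theorem gaux_X {R : Type*} [Ring R] (hR : IsGUSCRing R) {p x y : R} (hp : p * p = p)
    (hy : y * p = y) (hx : x * p = x) (hpx : p * x = x) (hn : ¬ IsUnit (1 + y * x)) :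
    ∃ g s : R, g ≠ 0 ∧ g * g = g ∧ p * g = g ∧ g * p = g ∧ g * s = s ∧ s * p = s ∧
      s * x * g = g := by
  obtain ⟨e, ⟨he, ⟨D, hD⟩, hc⟩, -⟩ := hR _ hn
  have he' : e * e = e := he
  have hDe : (D : R) * e = e * D := by
    rw [hD, sub_mul, mul_sub, hc]
  have hDi : (↑D⁻¹ : R) * e = e * ↑D⁻¹ := by
    rw [Units.inv_mul_eq_iff_eq_mul, ← mul_assoc, hDe, mul_assoc, Units.mul_inv, mul_one]
  have hyx : y * x * e = D * e := by
    rw [hD]; simp only [sub_mul, add_mul, one_mul, he']; abel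
  have hs : e * ↑D⁻¹ * y * x * e = e := by
    calc e * ↑D⁻¹ * y * x * e = e * ↑D⁻¹ * (y * x * e) := by simp only [mul_assoc]
      _ = e := by rw [hyx, mul_assoc, Units.inv_mul_cancel_left, he']
  have he0 : e ≠ 0 := by
    rintro rfl
    rw [sub_zero] at hD
    exact hn (hD ▸ D.isUnit)
  obtain ⟨s, hsdef⟩ : ∃ s, s = e * ↑D⁻¹ * y := ⟨_, rfl⟩
  rw [← hsdef] at hs
  have hes : e * s = s := by rw [hsdef]; simp only [← mul_assoc, he']
  have hsp : s * p = s := by rw [hsdef, mul_assoc, hy]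
  have hsxs : s * x * s = s := by
    calc s * x * s = s * x * e * s := by rw [mul_assoc (s * x), hes]
      _ = s := by rw [hs, hes]
  have hxp' : ∀ t, x * (p * t) = x * t := fun t => by rw [← mul_assoc, hx]
  have hsx' : s * (x * s) = s := by rw [← mul_assoc, hsxs]
  have hsx'' : ∀ t, s * (x * (s * t)) = s * t := fun t => by
    rw [← mul_assoc x, ← mul_assoc s, hsx']
  have hpp : ∀ t, p * (p * t) = p * t := fun t => by rw [← mul_assoc, hp]
  refine ⟨p * s * x, p * s, ?_, ?_, ?_, ?_, ?_, ?_, ?_⟩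
  · intro h0
    apply he0
    calc e = s * x * (p * s * x) * e := by
          simp only [mul_assoc, hxp', hsx'']
          rw [← mul_assoc, hs]
      _ = 0 := by rw [h0, mul_zero, zero_mul]
  · simp only [mul_assoc, hxp', hsx'']
  · simp only [mul_assoc, hpp]
  · simp only [mul_assoc, hx]
  · simp only [mul_assoc, hxp', hsx']
  · simp only [mul_assoc, hsp]
  · simp only [mul_assoc, hxp', hsx'']

theorem gaux_B {R : Type*} [Ring R] (hR : IsGUSCRing R) {p g x y : R} (hp : p * p = p)
    (hp1 : p ≠ 1) (hg : g * g = g) (hpg : p * g = g) (hgp : g * p = g) (hy : y * p = y) :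
    IsUnit (1 + y * ((p - g) * x * g)) := by
  by_contra hn
  obtain ⟨G, hG⟩ : ∃ G, G = p - g := ⟨_, rfl⟩
  rw [← hG] at hn
  have hGG : G * G = G := by rw [hG]; simp only [mul_sub, sub_mul, hp, hg, hpg, hgp]; abel
  have hgG : g * G = 0 := by rw [hG]; simp only [mul_sub, hg, hgp]; abel
  have hpG : p * G = G := by rw [hG]; simp only [mul_sub, hp, hpg]
  obtain ⟨r, hr⟩ : ∃ r, r = G * x * g := ⟨_, rfl⟩
  rw [← hr] at hn
  have hrg : r * g = r := by rw [hr, mul_assoc, hg]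
  have hGr : G * r = r := by rw [hr]; simp only [← mul_assoc, hGG]
  have hpr : p * r = r := by rw [← hGr, ← mul_assoc, hpG]
  obtain ⟨k, s0, hk0, hkk, hpk, hkp, hks, hsp, hsr⟩ :=
    gaux_X hR hp hy (by rw [← hrg, mul_assoc, hgp]) hpr hn
  obtain ⟨s, hs⟩ : ∃ s, s = s0 * G := ⟨_, rfl⟩
  have hsr' : s * r * k = k := by rw [hs, mul_assoc s0, hGr, hsr]
  have hks' : k * s = s := by rw [hs, ← mul_assoc, hks]
  have hsG : s * G = s := by rw [hs, mul_assoc, hGG]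
  have hsrs : s * r * s = s := by
    calc s * r * s = s * r * k * s := by rw [mul_assoc (s * r), hks']
      _ = s := by rw [hsr', hks']
  have hrg' : ∀ t, r * (g * t) = r * t := fun t => by rw [← mul_assoc, hrg]
  have hsrs' : s * (r * s) = s := by rw [← mul_assoc, hsrs]
  have hsrs'' : ∀ t, s * (r * (s * t)) = s * t := fun t => by
    rw [← mul_assoc r, ← mul_assoc s, hsrs']
  have hrr : r * r = 0 := by
    calc r * r = r * (g * G) * r := by
          rw [mul_assoc, mul_assoc, hGr, hrg']
      _ = 0 := by rw [hgG, mul_zero, zero_mul]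
  have hGg : G * g = 0 := by rw [hG]; simp only [sub_mul, hg, hpg]; abel
  have hsgz : s * g = 0 := by rw [← hsG, mul_assoc, hGg, mul_zero]
  have hsgz' : ∀ t, s * (g * t) = 0 := fun t => by rw [← mul_assoc, hsgz, zero_mul]
  have hrr' : ∀ t, r * (r * t) = 0 := fun t => by rw [← mul_assoc, hrr, zero_mul]
  have hpr' : ∀ t, p * (r * t) = r * t := fun t => by rw [← mul_assoc, hpr]
  have hpg' : ∀ t, p * (g * t) = g * t := fun t => by rw [← mul_assoc, hpg]
  have h0 : r * s * r = 0 := by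
    apply gaux_A hR (b := g * s)
    · simp only [mul_assoc, hrr', mul_zero]
    · simp only [mul_assoc, hsgz', mul_zero]
    · simp only [mul_assoc, hrg', hsrs'']
    · simp only [mul_assoc, hrg', hsrs', hsrs'']
    · intro h
      apply hp1
      have h2 := congrArg (fun t => p * t) h
      simp only [mul_add, mul_assoc, hpr', hpg', mul_one] at h2
      simp only [mul_assoc] at h
      rw [← h2, h]
  apply hk0
  calc k = s * (r * s * r) * k := by
        simp only [mul_assoc, hsrs'']
        rw [← mul_assoc, hsr']
    _ = 0 := by rw [h0, mul_zero, zero_mul]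

theorem gaux_L1 {R : Type*} [Ring R] (hR : IsGUSCRing R) {v : Rˣ}
    (H : ∀ f : R, f * f = f → IsUnit ((v : R) - f) → f = 0) {f t : R} (hf : f * f = f)
    (h : f * t * f * (1 - ↑v⁻¹) * f = f) : f = 0 := by
  obtain ⟨w, hw⟩ : ∃ w : R, w = 1 - ↑v⁻¹ := ⟨_, rfl⟩
  rw [← hw] at h
  apply H f hf
  have hvf : (v : R) - f = v * (1 - f + w * f) := by
    rw [hw]; simp only [mul_add, mul_sub, sub_mul, mul_one, one_mul, Units.mul_inv_cancel_left]
    abel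
  rw [hvf]
  refine v.isUnit.mul (gaux_DF hR (z := (1 - (1 - f) * w * f) * (f * t * f + 1 - f)) ?_)
  have hff : ∀ t, f * (f * t) = f * t := fun t => by rw [← mul_assoc, hf]
  have h1 : f * (t * (f * (w * f))) = f := by simpa only [mul_assoc] using h
  have e1 : (f * t * f + 1 - f) * (1 - f + w * f) = 1 + (1 - f) * w * f := by
    simp only [mul_add, add_mul, mul_sub, sub_mul, mul_one, one_mul, mul_assoc, hf, h1]
    abel
  rw [mul_assoc, e1]
  simp only [mul_add, mul_sub, sub_mul, mul_one, one_mul, mul_assoc, hff]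
  abel

theorem gaux_main {R : Type*} [Ring R] (hR : IsGUSCRing R) (v : Rˣ)
    (H : ∀ f : R, f * f = f → IsUnit ((v : R) - f) → f = 0) (y : R) :
    IsUnit (1 + y * (1 - ↑v⁻¹)) := by
  have L1 := fun f t => gaux_L1 hR H (f := f) (t := t)
  by_contra hn
  obtain ⟨w, hw⟩ : ∃ w : R, w = 1 - ↑v⁻¹ := ⟨_, rfl⟩
  rw [← hw] at hn L1
  obtain ⟨p, z, hp0, hp, -, -, hpz, -, hzw⟩ :=
    gaux_X hR (p := 1) (mul_one 1) (mul_one y) (mul_one w) (one_mul w) hn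
  have hp1 : p ≠ 1 := by
    rintro rfl
    apply hp0
    apply L1 1 z (mul_one 1)
    simpa only [mul_one, one_mul] using hzw
  have hpp : ∀ t, p * (p * t) = p * t := fun t => by rw [← mul_assoc, hp]
  have hpz' : ∀ t, p * (z * t) = z * t := fun t => by rw [← mul_assoc, hpz]
  have hzw' : z * (w * p) = p := by rw [← mul_assoc, hzw]
  have hzw'' : ∀ t, z * (w * (p * t)) = p * t := fun t => by
    rw [← mul_assoc w, ← mul_assoc z, hzw']
  by_cases hc : IsUnit (1 + (p - z * p) * (p * w * p))
  · -- the idempotent `p + z (1 - p)`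
    obtain ⟨q, hq⟩ := hc.exists_left_inv
    apply hp0
    have hf : p + z * (1 - p) = 0 := by
      apply L1 _ (p * q * p)
      · simp only [mul_add, add_mul, mul_sub, sub_mul, mul_one, mul_assoc, hp, hpz, hpp, hpz']
        abel
      · have c1 : (p + z * (1 - p)) * (p * q * p) = p * q * p := by
          simp only [mul_add, add_mul, mul_sub, sub_mul, mul_one, mul_assoc, hpp]
          abel
        have c2 : (p + z * (1 - p)) * w * p = p * (1 + (p - z * p) * (p * w * p)) * p := by
          simp only [mul_add, add_mul, mul_sub, sub_mul, mul_one, mul_assoc, hp, hpp, hpz', hzw']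
          abel
        have c3 : p * (p + z * (1 - p)) = p + z * (1 - p) := by
          simp only [mul_add, mul_sub, mul_one, hp, hpz, hpz']
        have c5 : p * (1 + (p - z * p) * (p * w * p)) * p
            = (1 + (p - z * p) * (p * w * p)) * p := by
          simp only [mul_add, add_mul, mul_sub, sub_mul, mul_one, one_mul, mul_assoc, hp, hpp, hpz']
        have c6 : p * ((1 + (p - z * p) * (p * w * p)) * p)
            = (1 + (p - z * p) * (p * w * p)) * p := by rw [← mul_assoc, c5]
        rw [c1]
        calc p * q * p * (p + z * (1 - p)) * w * (p + z * (1 - p))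
            = p * q * p * ((p + z * (1 - p)) * w * p) * (p + z * (1 - p)) := by
              conv_lhs => rw [← c3]
              simp only [mul_assoc, hpp, hpz']
          _ = p * (q * (1 + (p - z * p) * (p * w * p))) * p * (p + z * (1 - p)) := by
              rw [c2, c5, mul_assoc (p * q) p, c6]; simp only [mul_assoc]
          _ = p + z * (1 - p) := by rw [hq, mul_one, hp, c3]
    calc p = (p + z * (1 - p)) * p := by
          simp only [add_mul, mul_sub, sub_mul, mul_one, mul_assoc, hp]; abel
      _ = 0 := by rw [hf, zero_mul]
  · obtain ⟨g, s, hg0, hg, hpg, hgp, hgs, hsp, hsx⟩ :=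
      gaux_X hR (p := p) (x := p * w * p) (y := p - z * p) hp
        (by simp only [sub_mul, mul_assoc, hp]) (by simp only [mul_assoc, hp])
        (by simp only [mul_assoc, hpp]) hc
    have hu := gaux_B hR (p := p) (g := g) (x := p * w * p) (y := -s) hp hp1 hg hpg hgp
      (by rw [neg_mul, hsp])
    obtain ⟨q, hq⟩ := hu.exists_left_inv
    apply hg0
    apply L1 g (q * s) hg
    have hsx' : s * (p * (w * g)) = g := by simpa only [mul_assoc, hpg] using hsx
    have hsp' : ∀ t, s * (p * t) = s * t := fun t => by rw [← mul_assoc, hsp]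
    have d1 : s * g * w * g = (1 + -s * ((p - g) * (p * w * p) * g)) * g := by
      have hgp' : ∀ t, g * (p * t) = g * t := fun t => by rw [← mul_assoc, hgp]
      have hsx2 : s * (w * g) = g := by rw [← hsp', hsx']
      simp only [mul_sub, add_mul, sub_mul, neg_mul, one_mul, mul_assoc, hg, hpg, hgp', hpp, hsp',
        hsx2]
      abel
    calc g * (q * s) * g * w * g = g * q * (s * g * w * g) := by simp only [mul_assoc]
      _ = g * (q * (1 + -s * ((p - g) * (p * w * p) * g))) * g := by
          rw [d1]; simp only [mul_assoc]
      _ = g := by rw [hq, mul_one, hg]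

theorem gaux_swap {R : Type*} [Ring R] {a b : R} (h : IsUnit (1 + a * b)) :
    IsUnit (1 + b * a) := by
  obtain ⟨u, hu⟩ := h
  have h1 : (u : R) * ↑u⁻¹ = 1 := u.mul_inv
  have h2 : (↑u⁻¹ : R) * u = 1 := u.inv_mul
  rw [hu] at h1 h2
  obtain ⟨c, hc⟩ : ∃ c : R, c = ↑u⁻¹ := ⟨_, rfl⟩
  rw [← hc] at h1 h2
  have k1 : c + a * b * c = 1 := by simpa only [add_mul, one_mul] using h1
  have k2 : c + c * (a * b) = 1 := by simpa only [mul_add, mul_one] using h2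
  refine gaux_unit (y := 1 - b * c * a) ?_ ?_
  · calc (1 + b * a) * (1 - b * c * a) = 1 + b * a - b * (c + a * b * c) * a := by noncomm_ring
      _ = 1 := by rw [k1]; noncomm_ring
  · calc (1 - b * c * a) * (1 + b * a) = 1 + b * a - b * (c + c * (a * b)) * a := by noncomm_ring
      _ = 1 := by rw [k2]; noncomm_ring

theorem gaux_fwd {R : Type*} [Ring R] (hR : IsGUSCRing R) (a : R) (ha : IsUniquelyClean a) :
    ∃ e j : R, IsIdempotentElem e ∧ (∀ r : R, e * r = r * e) ∧ InJacobson j ∧ a = e + j := by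
  obtain ⟨e, he, hu, hc⟩ : ∃ e : R, e * e = e ∧ IsUnit (a - e) ∧ a * e = e * a := by
    by_cases h : IsUnit a
    · exact ⟨0, mul_zero 0, by rwa [sub_zero], by rw [mul_zero, zero_mul]⟩
    · obtain ⟨e, ⟨h1, h2, h3⟩, -⟩ := hR a h
      exact ⟨e, h1, h2, h3⟩
  have huniq : ∀ f : R, f * f = f → IsUnit (a - f) → f = e := fun f h1 h2 =>
    ha.unique ⟨h1, h2⟩ ⟨he, hu⟩
  obtain ⟨u, hu⟩ := hu
  have hau : a = e + u := by rw [hu]; abel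
  have hue : (u : R) * e = e * u := by rw [hu, sub_mul, mul_sub, hc]
  have hui : (↑u⁻¹ : R) * e = e * ↑u⁻¹ := by
    rw [Units.inv_mul_eq_iff_eq_mul, ← mul_assoc, hue, mul_assoc, Units.mul_inv, mul_one]
  have hee : ∀ t, e * (e * t) = e * t := fun t => by rw [← mul_assoc, he]
  have hui' : ∀ t, (↑u⁻¹ : R) * (e * t) = e * (↑u⁻¹ * t) := fun t => by
    rw [← mul_assoc, hui, mul_assoc]
  -- perturbations by square-zero elements
  have pert : ∀ n : R, n * ↑u⁻¹ * n = 0 → (e + n) * (e + n) = e + n → n = 0 := by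
    intro n hn hid
    have : e + n = e := by
      apply huniq _ hid
      have h1 : a - (e + n) = u * (1 - ↑u⁻¹ * n) := by
        rw [mul_sub, mul_one, Units.mul_inv_cancel_left, hau]; abel
      rw [h1]
      refine u.isUnit.mul (gaux_unit (y := 1 + ↑u⁻¹ * n) ?_ ?_)
      · calc (1 - ↑u⁻¹ * n) * (1 + ↑u⁻¹ * n) = 1 - ↑u⁻¹ * (n * ↑u⁻¹ * n) := by noncomm_ring
          _ = 1 := by rw [hn, mul_zero, sub_zero]
      · calc (1 + ↑u⁻¹ * n) * (1 - ↑u⁻¹ * n) = 1 - ↑u⁻¹ * (n * ↑u⁻¹ * n) := by noncomm_ring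
          _ = 1 := by rw [hn, mul_zero, sub_zero]
    exact add_eq_left.1 this
  have hcen : ∀ r : R, e * r = r * e := by
    intro r
    have h1 : e * r - e * r * e = 0 := by
      apply pert
      · simp only [mul_sub, sub_mul, mul_assoc, hui', hee]
        abel
      · simp only [mul_add, add_mul, mul_sub, sub_mul, mul_assoc, he, hee]
        abel
    have h2 : r * e - e * r * e = 0 := by
      apply pert
      · simp only [mul_sub, sub_mul, mul_assoc, hui', hee]
        abel
      · simp only [mul_add, add_mul, mul_sub, sub_mul, mul_assoc, he, hee]
        abel
    rw [sub_eq_zero.1 h1, sub_eq_zero.1 h2]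
  have hinv : (1 - 2 * e) * (1 - 2 * e) = 1 := by
    calc (1 - 2 * e) * (1 - 2 * e) = 1 - 4 * e + 4 * (e * e) := by noncomm_ring
      _ = 1 := by rw [he]; noncomm_ring
  let c : Rˣ := ⟨1 - 2 * e, 1 - 2 * e, hinv, hinv⟩
  have hcv : (c : R) = 1 - 2 * e := rfl
  have H : ∀ f : R, f * f = f → IsUnit (((c * u : Rˣ) : R) - f) → f = 0 := by
    intro f hf hfu
    have hfe : e * f = f * e := hcen f
    have h1 : f + e - 2 * (e * f) = e := by
      apply huniq
      · have i1 : f * (e * f) = e * f := by rw [← mul_assoc, ← hfe, mul_assoc, hf]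
        simp only [two_mul, mul_add, add_mul, mul_sub, sub_mul, mul_assoc, he, hf, hee, ← hfe, i1]
        abel
      · have h2 : a - (f + e - 2 * (e * f)) = c * (((c * u : Rˣ) : R) - f) := by
          rw [Units.val_mul, mul_sub, ← mul_assoc (c : R), hcv, hinv, hau]
          noncomm_ring
        rw [h2]
        exact c.isUnit.mul hfu
    have h3 : (1 - 2 * e) * f = 0 := by
      calc (1 - 2 * e) * f = (f + e - 2 * (e * f)) - e := by noncomm_ring
        _ = 0 := by rw [h1, sub_self]
    calc f = (1 - 2 * e) * ((1 - 2 * e) * f) := by rw [← mul_assoc, hinv, one_mul]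
      _ = 0 := by rw [h3, mul_zero]
  refine ⟨1 - e, a - (1 - e), ?_, ?_, ?_, by abel⟩
  · exact IsIdempotentElem.one_sub he
  · intro r; rw [sub_mul, mul_sub, hcen, one_mul, mul_one]
  · intro y
    have h1 := gaux_swap (gaux_main hR (c * u) H (-(y * u)))
    have hcu : (u : R) - c = u * (1 - ↑(c * u)⁻¹) := by
      rw [mul_inv_rev, Units.val_mul, mul_sub, mul_one, Units.mul_inv_cancel_left]
      rfl
    have h2 : a - (1 - e) = u - c := by rw [hau, hcv]; noncomm_ring
    rw [h2, hcu]
    have h3 := gaux_main hR (c * u) H (-(y * u))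
    have h4 : 1 + -(y * ↑u) * (1 - (↑(c * u)⁻¹ : R)) = 1 + (-y) * (u * (1 - ↑(c * u)⁻¹)) := by
      simp only [neg_mul, mul_assoc]
    rw [h4] at h3
    have h5 := gaux_swap h3
    rwa [mul_neg, ← sub_eq_add_neg] at h5

theorem gaux_bwd {R : Type*} [Ring R] (f j : R) (hf : f * f = f) (hc : ∀ r : R, f * r = r * f)
    (hj : InJacobson j) : IsUniquelyClean (f + j) := by
  have hinv : (2 * f - 1) * (2 * f - 1) = 1 := by
    calc (2 * f - 1) * (2 * f - 1) = 1 - 4 * f + 4 * (f * f) := by noncomm_ring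
      _ = 1 := by rw [hf]; noncomm_ring
  refine ⟨1 - f, ⟨IsIdempotentElem.one_sub hf, ?_⟩, ?_⟩
  · have h1 : f + j - (1 - f) = (1 - j * (-(2 * f - 1))) * (2 * f - 1) := by
      calc f + j - (1 - f) = 2 * f - 1 + j * 1 := by noncomm_ring
        _ = 2 * f - 1 + j * ((2 * f - 1) * (2 * f - 1)) := by rw [hinv]
        _ = _ := by noncomm_ring
    rw [h1]
    exact (hj _).mul (gaux_unit hinv hinv)
  · rintro e ⟨he, ⟨u, hu⟩⟩
    have he' : e * e = e := he
    have h1 : IsUnit (f - e) := by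
      have h2 : f - e = (1 - j * ↑u⁻¹) * u := by
        rw [sub_mul, one_mul, mul_assoc, Units.inv_mul, mul_one, hu]; abel
      rw [h2]
      exact (hj _).mul u.isUnit
    have hef : e * f = f * e := (hc e).symm
    have h3 : (f - e) * (f * e) = 0 := by
      have : e * (f * e) = f * e := by rw [← mul_assoc, hef, mul_assoc, he']
      rw [sub_mul, this, ← mul_assoc, hf, sub_self]
    have h4 := h1.mul_right_eq_zero.1 h3
    have h5 : (f - e) * (1 - f - e) = 0 := by
      simp only [mul_sub, sub_mul, mul_one, hf, he', hef, h4]; abel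
    have h6 := h1.mul_right_eq_zero.1 h5
    exact (sub_eq_zero.1 h6).symm

/-- In a GUSC ring, ucn(R) = ucn₀(R). -/
theorem gusc_ucn_eq_ucn0 {R : Type*} [Ring R] (hR : IsGUSCRing R) :
    ∀ a : R, IsUniquelyClean a ↔
      ∃ e j : R, IsIdempotentElem e ∧ (∀ r : R, e * r = r * e) ∧ InJacobson j ∧ a = e + j := by
  intro a
  constructor
  · exact gaux_fwd hR a
  · rintro ⟨e, j, he, hc, hj, rfl⟩
    exact gaux_bwd e j he hc hj
end

section
/- Let R be a ring such that for every non-invertible element a of R there exists a unique idempotent e of R with a - e \in J(R). Then R is a GUC ring, i.e., every non-invertible element of R is uniquely clean. -/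
theorem InJacobson.mul_right' {R : Type*} [Ring R] {a : R} (ha : InJacobson a) (b : R) :
    InJacobson (a * b) := fun y => by rw [mul_assoc]; exact ha _

theorem isUnit_one_sub_swap {R : Type*} [Ring R] {a b : R} (h : IsUnit (1 - a * b)) :
    IsUnit (1 - b * a) := by
  obtain ⟨u, hu⟩ := h
  have h1 : (1 - a * b) * (↑u⁻¹ : R) = 1 := by rw [← hu]; simp
  have h2 : (↑u⁻¹ : R) * (1 - a * b) = 1 := by rw [← hu]; simp
  refine ⟨⟨1 - b * a, 1 + b * ↑u⁻¹ * a, ?_, ?_⟩, rfl⟩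
  · calc (1 - b * a) * (1 + b * ↑u⁻¹ * a)
        = 1 - b * a + b * ((1 - a * b) * ↑u⁻¹) * a := by noncomm_ring
      _ = 1 := by rw [h1]; simp
  · calc (1 + b * ↑u⁻¹ * a) * (1 - b * a)
        = 1 - b * a + b * (↑u⁻¹ * (1 - a * b)) * a := by noncomm_ring
      _ = 1 := by rw [h2]; simp

theorem InJacobson.mul_left' {R : Type*} [Ring R] {a : R} (ha : InJacobson a) (b : R) :
    InJacobson (b * a) := fun y => by
  rw [mul_assoc]; apply isUnit_one_sub_swap; rw [mul_assoc]; exact ha _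

theorem InJacobson.unit_sub {R : Type*} [Ring R] {a u : R} (ha : InJacobson a) (hu : IsUnit u) :
    IsUnit (u - a) := by
  obtain ⟨u, rfl⟩ := hu
  have h := (ha (↑u⁻¹)).mul u.isUnit
  rwa [sub_mul, one_mul, mul_assoc, Units.inv_mul, mul_one] at h

theorem InJacobson.neg' {R : Type*} [Ring R] {a : R} (ha : InJacobson a) : InJacobson (-a) := by
  simpa using ha.mul_right' (-1)

theorem InJacobson.add' {R : Type*} [Ring R] {a b : R} (ha : InJacobson a) (hb : InJacobson b) :
    InJacobson (a + b) := fun y => by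
  have := (hb.mul_right' y).unit_sub (ha y)
  rwa [sub_sub, ← add_mul] at this

theorem InJacobson.idem {R : Type*} [Ring R] {p : R} (hp : InJacobson p)
    (h : IsIdempotentElem p) : p = 0 := by
  have h1 := hp 1
  rw [mul_one] at h1
  apply h1.mul_left_cancel
  rw [sub_mul, h.eq]; simp

theorem injac_of_sq {R : Type*} [Ring R]
    (h : ∀ a : R, ¬ IsUnit a → ∃! e : R, IsIdempotentElem e ∧ InJacobson (a - e))
    {n : R} (hn : n * n = 0) : InJacobson n := by
  by_cases hu : IsUnit n
  · have : n = 0 := hu.mul_left_cancel (by rw [hn, mul_zero])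
    intro y; simp [this]
  · obtain ⟨p, ⟨hp, hj⟩, -⟩ := h n hu
    have h1 : (n - p) * n + p * (n - p) = -p := by
      have : (n - p) * n + p * (n - p) = n * n - p * p := by noncomm_ring
      rw [this, hn, hp.eq, zero_sub]
    have h2 := ((hj.mul_right' n).add' (hj.mul_left' p)).neg'
    rw [h1, neg_neg] at h2
    have := h2.idem hp
    simpa [this] using hj

theorem corner_zero {R : Type*} [Ring R]
    (h : ∀ a : R, ¬ IsUnit a → ∃! e : R, IsIdempotentElem e ∧ InJacobson (a - e))
    {e n : R} (he : IsIdempotentElem e)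
    (hn : (e * n = n ∧ n * e = 0) ∨ (e * n = 0 ∧ n * e = n)) : n = 0 := by
  have hnn : n * n = 0 := by
    rcases hn with ⟨h1, h2⟩ | ⟨h1, h2⟩
    · calc n * n = n * (e * n) := by rw [h1]
        _ = 0 := by rw [← mul_assoc, h2, zero_mul]
    · calc n * n = (n * e) * n := by rw [h2]
        _ = 0 := by rw [mul_assoc, h1, mul_zero]
  have hs : e * n + n * e = n := by
    rcases hn with ⟨h1, h2⟩ | ⟨h1, h2⟩ <;> simp [h1, h2]
  by_cases hu : IsUnit e
  · have h1 : e = 1 := hu.mul_left_cancel (by rw [he.eq, mul_one])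
    subst h1
    rcases hn with ⟨h1, h2⟩ | ⟨h1, h2⟩
    · simpa using h2
    · simpa using h1
  · have hg : IsIdempotentElem (e + n) := by
      change (e + n) * (e + n) = e + n
      calc (e + n) * (e + n) = e * e + (e * n + n * e) + n * n := by noncomm_ring
        _ = e + n := by rw [he.eq, hs, hnn, add_zero]
    have := (h e hu).unique (y₁ := e + n) (y₂ := e)
      ⟨hg, by simpa using (injac_of_sq h hnn).neg'⟩ ⟨he, by intro y; simp⟩
    simpa using this

theorem idem_central {R : Type*} [Ring R]
    (h : ∀ a : R, ¬ IsUnit a → ∃! e : R, IsIdempotentElem e ∧ InJacobson (a - e))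
    {e : R} (he : IsIdempotentElem e) (x : R) : e * x = x * e := by
  have he' : e * e = e := he
  have h1 : e * x - e * x * e = 0 := corner_zero h he (Or.inl ⟨by
    rw [mul_sub, ← mul_assoc, ← mul_assoc, ← mul_assoc, he'], by
    rw [sub_mul, mul_assoc (e * x) e e, he', sub_self]⟩)
  have h2 : x * e - e * x * e = 0 := corner_zero h he (Or.inr ⟨by
    rw [mul_sub, ← mul_assoc, ← mul_assoc, ← mul_assoc, he', sub_self], by
    rw [sub_mul, mul_assoc (e * x) e e, mul_assoc x e e, he']⟩)
  rw [sub_eq_zero.1 h1, sub_eq_zero.1 h2]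

/-- If every non-invertible element has a unique idempotent congruent to it modulo J(R),
then R is GUC. -/
theorem guc_of_unique_idempotent_mod_jacobson {R : Type*} [Ring R]
    (h : ∀ a : R, ¬ IsUnit a → ∃! e : R, IsIdempotentElem e ∧ InJacobson (a - e)) :
    IsGUCRing R := by
  intro a ha
  obtain ⟨e, ⟨he, hj⟩, -⟩ := h a ha
  have he' : e * e = e := he
  refine ⟨1 - e, ⟨he.one_sub, ?_⟩, ?_⟩
  · have hu : IsUnit (2 * e - 1) := by
      have : (2 * e - 1) * (2 * e - 1) = 1 := by
        calc (2 * e - 1) * (2 * e - 1) = 4 * (e * e) - 4 * e + 1 := by noncomm_ring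
          _ = 1 := by rw [he']; simp
      exact ⟨⟨_, _, this, this⟩, rfl⟩
    have := hj.neg'.unit_sub hu
    have e1 : a - (1 - e) = 2 * e - 1 - -(a - e) := by noncomm_ring
    rwa [e1]
  · rintro f ⟨hf, hu⟩
    have hf' : f * f = f := hf
    have hu2 := hj.unit_sub hu
    have e1 : a - f - (a - e) = e - f := by abel
    rw [e1] at hu2
    have hc : f * e = e * f := idem_central h hf e
    have hef : e * f = 0 := by
      apply hu2.mul_left_cancel
      rw [sub_mul, ← mul_assoc, he', ← mul_assoc, hc, mul_assoc, hf', sub_self, mul_zero]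
    have h3 : e + f = 1 := by
      apply hu2.mul_left_cancel
      rw [sub_mul, mul_add, mul_add, he', hf', hc, hef]; simp
    exact eq_sub_of_add_eq' h3
end
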